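/- Let e ⊆ E_m with |e| = r, where 1 ≤ r ≤ 2^{m−1} − 1. Then the design d = O_m ∪ e (of cardinality 2^{m−1} + r) is a minimum aberration design among all subsets of H_m of cardinality 2^{m−1} + r if and only if no subset e′ ⊆ E_m with |e′| = r has smaller aberration than e. -/

import Mathlib

open Finset Polynomial

/-- The ambient 𝔽₂-vector space `V = (ZMod 2)^m`. -/
abbrev V (m : ℕ) := Fin m → ZMod 2

/-- `Hm m` is the set of the `2^m - 1` nonzero vectors of `V m`. -/
def Hm (m : ℕ) : Finset (V m) := Finset.univ.filter (fun v => v ≠ 0)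

/-- `Om m` is the set of odd-weight vectors of `V m`. -/
def Om (m : ℕ) : Finset (V m) := Finset.univ.filter (fun v => (∑ i, v i) = 1)

/-- `Em m` is the set of nonzero even-weight vectors of `V m`. -/
def Em (m : ℕ) : Finset (V m) := Finset.univ.filter (fun v => v ≠ 0 ∧ (∑ i, v i) = 0)

/-- The number of `i`-element subsets of `d` whose elements sum to `ψ`. -/
def sumCount (m : ℕ) (d : Finset (V m)) (i : ℕ) (ψ : V m) : ℕ :=
  ((d.powersetCard i).filter (fun S => S.sum id = ψ)).card

/-- `wordCount m d i = a_i(d)`, the number of `i`-element subsets of `d` summing to `0`. -/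
def wordCount (m : ℕ) (d : Finset (V m)) (i : ℕ) : ℕ := sumCount m d i 0

/-- The rank of a finite set of vectors: the dimension of its span over `𝔽₂`. -/
noncomputable def rankOf (m : ℕ) (f : Finset (V m)) : ℕ :=
  Module.finrank (ZMod 2) (Submodule.span (ZMod 2) (f : Set (V m)))

/-- `d₁` has smaller aberration than `d₂`. -/
def SmallerAberration (m : ℕ) (d₁ d₂ : Finset (V m)) : Prop :=
  ∃ s, 1 ≤ s ∧ wordCount m d₁ s < wordCount m d₂ s ∧
    ∀ t < s, wordCount m d₁ t = wordCount m d₂ t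

/-- `d` is a minimum aberration design. -/
def IsMA (m : ℕ) (d : Finset (V m)) : Prop :=
  d ⊆ Hm m ∧ ∀ d' ⊆ Hm m, d'.card = d.card → ¬ SmallerAberration m d' d

/-- The word-length pattern polynomial `P_f(X) = ∑ a_i(f) X^i` of a design `f`. -/
noncomputable def WLPP (m : ℕ) (f : Finset (V m)) : Polynomial ℤ :=
  ∑ i ∈ Finset.range (f.card + 1), (wordCount m f i : ℤ) • X ^ i

/-- `Q_ψ(X) = ∑ q_i(ψ) X^i`, where `q_i(ψ)` counts `i`-element subsets of `O_m` summing to `ψ`. -/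
noncomputable def Qpoly (m : ℕ) (ψ : V m) : Polynomial ℤ :=
  ∑ i ∈ Finset.range ((Om m).card + 1), (sumCount m (Om m) i ψ : ℤ) • X ^ i

/-! ### Characters of `V m` -/

lemma vec_add_self {m : ℕ} (x : V m) : x + x = 0 :=
  funext fun i => CharTwo.add_self_eq_zero (x i)

lemma vec_add_eq_zero_iff {m : ℕ} {x y : V m} : x + y = 0 ↔ x = y := by
  constructor
  · intro h
    calc x = x + (y + y) := by rw [vec_add_self, add_zero]
      _ = (x + y) + y := by abel
      _ = y := by rw [h, zero_add]
  · rintro rfl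
    exact vec_add_self x

lemma vec_add_cancel {m : ℕ} (x y : V m) : x + (x + y) = y := by
  rw [← add_assoc, vec_add_self, zero_add]

lemma zmod_two_eq_one_iff {a : ZMod 2} : a = 1 ↔ a ≠ 0 := by
  revert a; decide

/-- The character of `V m` attached to `u`. -/
def chr {m : ℕ} (u x : V m) : ℤ := if u ⬝ᵥ x = 0 then 1 else -1

lemma chr_add_right {m : ℕ} (u x y : V m) : chr u (x + y) = chr u x * chr u y := by
  unfold chr
  rw [dotProduct_add]
  generalize u ⬝ᵥ x = a
  generalize u ⬝ᵥ y = b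
  revert a b; decide

lemma chr_comm {m : ℕ} (u x : V m) : chr u x = chr x u := by
  unfold chr
  rw [dotProduct_comm]

lemma exists_coord_eq_one {m : ℕ} {x : V m} (hx : x ≠ 0) : ∃ i, x i = 1 := by
  by_contra! h
  exact hx (funext fun i => by simpa using mt zmod_two_eq_one_iff.2 (h i))

lemma sum_chr {m : ℕ} (x : V m) : ∑ u : V m, chr u x = if x = 0 then 2 ^ m else 0 := by
  split_ifs with hx
  · subst hx
    simp [chr]
  · obtain ⟨i, hi⟩ := exists_coord_eq_one hx
    have h1 : ∑ u : V m, chr (u + Pi.single i 1) x = ∑ u : V m, chr u x :=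
      Equiv.sum_comp (Equiv.addRight (Pi.single i (1 : ZMod 2) : V m)) (fun u => chr u x)
    have h2 : ∀ u : V m, chr (u + Pi.single i 1) x = -chr u x := by
      intro u
      rw [chr_comm, chr_add_right, chr_comm x u, chr_comm x]
      simp [chr, hi]
    simp only [h2, Finset.sum_neg_distrib] at h1
    linarith

/-- The Fourier transform of the indicator function of `A`. -/
def chrSum {m : ℕ} (A : Finset (V m)) (u : V m) : ℤ := ∑ x ∈ A, chr u x

/-- The number of pairs in `A` whose sum lies in `A`. -/
def addTriples {m : ℕ} (A : Finset (V m)) : ℕ :=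
  ((A ×ˢ A).filter (fun p => p.1 + p.2 ∈ A)).card

lemma addTriples_eq_sum {m : ℕ} (A : Finset (V m)) :
    (addTriples A : ℤ) = ∑ x ∈ A, ∑ y ∈ A, if x + y ∈ A then 1 else 0 := by
  rw [addTriples, Finset.card_filter, Finset.sum_product]
  push_cast
  rfl

lemma sum_chrSum {m : ℕ} {A : Finset (V m)} (h0 : 0 ∈ A) : ∑ u, chrSum A u = 2 ^ m := by
  simp only [chrSum]
  rw [Finset.sum_comm]
  simp [sum_chr, h0]

lemma sum_chrSum_sq {m : ℕ} (A : Finset (V m)) : ∑ u, chrSum A u ^ 2 = 2 ^ m * A.card := by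
  simp only [chrSum, sq, Finset.sum_mul_sum, ← chr_add_right]
  rw [Finset.sum_comm]
  simp_rw [Finset.sum_comm (s := Finset.univ), sum_chr, vec_add_eq_zero_iff]
  simp [mul_comm]

lemma sum_chrSum_cube {m : ℕ} (A : Finset (V m)) :
    ∑ u, chrSum A u ^ 3 = 2 ^ m * addTriples A := by
  have hadd : ∀ x y z : V m, z + y = x ↔ z = x + y := fun x y z =>
    ⟨by rintro rfl; rw [add_assoc, vec_add_self, add_zero],
      by rintro rfl; rw [add_assoc, vec_add_self, add_zero]⟩
  simp only [chrSum, pow_succ, pow_zero, one_mul, Finset.sum_mul,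
    Finset.mul_sum, ← chr_add_right]
  rw [Finset.sum_comm]
  simp_rw [Finset.sum_comm (s := Finset.univ), sum_chr, vec_add_eq_zero_iff]
  rw [addTriples_eq_sum, Finset.mul_sum]
  refine Finset.sum_congr rfl fun x _ => ?_
  rw [Finset.mul_sum]
  refine Finset.sum_congr rfl fun y _ => ?_
  simp [hadd]

/-! ### Annihilators -/

/-- The vectors orthogonal to all of `A`. -/
def annih {m : ℕ} (A : Finset (V m)) : Finset (V m) :=
  Finset.univ.filter fun u => ∀ x ∈ A, u ⬝ᵥ x = 0

lemma mem_annih {m : ℕ} {A : Finset (V m)} {u : V m} : u ∈ annih A ↔ ∀ x ∈ A, u ⬝ᵥ x = 0 := by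
  simp [annih]

lemma add_mem_annih {m : ℕ} {A : Finset (V m)} {u w : V m} (hu : u ∈ annih A)
    (hw : w ∈ annih A) : u + w ∈ annih A := by
  rw [mem_annih] at *
  intro x hx
  rw [add_dotProduct, hu x hx, hw x hx, add_zero]

lemma zero_mem_annih {m : ℕ} (A : Finset (V m)) : 0 ∈ annih A := by
  simp [mem_annih]

lemma chrSum_of_mem_annih {m : ℕ} {A : Finset (V m)} {u : V m} (hu : u ∈ annih A) :
    chrSum A u = A.card := by
  rw [chrSum, Finset.card_eq_sum_ones]
  push_cast
  refine Finset.sum_congr rfl fun x hx => ?_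
  rw [chr, if_pos (mem_annih.1 hu x hx)]

lemma subset_annih_annih {m : ℕ} (A : Finset (V m)) : A ⊆ annih (annih A) := by
  intro x hx
  rw [mem_annih]
  intro u hu
  rw [dotProduct_comm]
  exact mem_annih.1 hu x hx

/-- A character that is nontrivial on a subgroup sums to zero over it. -/
lemma chrSum_of_notMem_annih {m : ℕ} {A : Finset (V m)} (hA : ∀ x ∈ A, ∀ y ∈ A, x + y ∈ A)
    {u : V m} (hu : u ∉ annih A) : chrSum A u = 0 := by
  rw [mem_annih] at hu
  push Not at hu
  obtain ⟨a, ha, hua⟩ := hu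
  have h1 : ∑ x ∈ A, chr u (a + x) = ∑ x ∈ A, chr u x :=
    Finset.sum_bij' (fun x _ => a + x) (fun x _ => a + x) (fun x hx => hA a ha x hx)
      (fun x hx => hA a ha x hx) (fun x _ => vec_add_cancel a x) (fun x _ => vec_add_cancel a x)
      (fun _ _ => rfl)
  have h2 : chr u a = -1 := by simp [chr, hua]
  simp only [chr_add_right, h2, neg_one_mul, Finset.sum_neg_distrib] at h1
  rw [chrSum]
  linarith

lemma card_mul_card_annih {m : ℕ} {A : Finset (V m)} (h0 : 0 ∈ A)
    (hA : ∀ x ∈ A, ∀ y ∈ A, x + y ∈ A) : A.card * (annih A).card = 2 ^ m := by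
  have h := sum_chrSum h0
  rw [← Finset.sum_subset (Finset.subset_univ (annih A))
    (fun u _ hu => chrSum_of_notMem_annih hA hu),
    Finset.sum_congr rfl (fun u hu => chrSum_of_mem_annih hu)] at h
  simp only [Finset.sum_const, nsmul_eq_mul] at h
  rw [mul_comm]
  exact_mod_cast h

lemma exists_card_annih {m : ℕ} (A : Finset (V m)) :
    ∃ k l, (annih A).card = 2 ^ k ∧ (annih (annih A)).card = 2 ^ l ∧ 2 ^ m = 2 ^ l * 2 ^ k := by
  have h := card_mul_card_annih (zero_mem_annih A) (fun _ hx _ hy => add_mem_annih hx hy)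
  obtain ⟨k, -, hk⟩ := (Nat.dvd_prime_pow Nat.prime_two).1 (Dvd.intro _ h)
  obtain ⟨l, -, hl⟩ := (Nat.dvd_prime_pow Nat.prime_two).1 (Dvd.intro_left _ h)
  refine ⟨k, l, hk, hl, ?_⟩
  rw [← h, hk, hl, mul_comm]

/-! ### Counting additive triples -/

lemma addTriples_compl {m : ℕ} {U A : Finset (V m)} (hU : ∀ x ∈ U, ∀ y ∈ U, x + y ∈ U)
    (hA : A ⊆ U) : (addTriples A : ℤ) + addTriples (U \ A) =
      U.card ^ 2 - 3 * U.card * A.card + 3 * A.card ^ 2 := by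
  let a : V m → ℤ := fun x => if x ∈ A then 1 else 0
  have hsum : ∑ x ∈ U, a x = A.card := by
    simp only [a, Finset.sum_boole, Finset.filter_mem_eq_inter, Finset.inter_eq_right.2 hA]
  have hshift : ∀ x ∈ U, ∑ y ∈ U, a (x + y) = A.card := by
    intro x hx
    rw [← hsum]
    exact Finset.sum_bij' (fun y _ => x + y) (fun y _ => x + y) (fun y hy => hU x hx y hy)
      (fun y hy => hU x hx y hy) (fun y _ => vec_add_cancel x y) (fun y _ => vec_add_cancel x y)
      (fun _ _ => rfl)
  have hTA : (addTriples A : ℤ) = ∑ x ∈ U, ∑ y ∈ U, a x * a y * a (x + y) := by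
    rw [addTriples_eq_sum, ← Finset.sum_subset hA (fun x _ hx => by simp [a, hx])]
    refine Finset.sum_congr rfl fun x hx => ?_
    rw [← Finset.sum_subset hA (fun y _ hy => by simp [a, hy])]
    refine Finset.sum_congr rfl fun y hy => ?_
    simp [a, hx, hy]
  have hTB : (addTriples (U \ A) : ℤ) =
      ∑ x ∈ U, ∑ y ∈ U, (1 - a x) * (1 - a y) * (1 - a (x + y)) := by
    rw [addTriples_eq_sum, ← Finset.sum_subset (Finset.sdiff_subset (s := U) (t := A))
      (fun x hx hx' => by
        have : x ∈ A := by simpa [hx] using hx'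
        simp [a, this])]
    refine Finset.sum_congr rfl fun x hx => ?_
    rw [← Finset.sum_subset (Finset.sdiff_subset (s := U) (t := A))
      (fun y hy hy' => by
        have : y ∈ A := by simpa [hy] using hy'
        simp [a, this])]
    refine Finset.sum_congr rfl fun y hy => ?_
    rw [Finset.mem_sdiff] at hx hy
    have := hU x hx.1 y hy.1
    by_cases h : x + y ∈ A <;> simp [a, hx, hy, this, h]
  rw [hTA, hTB, ← Finset.sum_add_distrib]
  simp only [← Finset.sum_add_distrib]
  have key : ∀ x ∈ U, ∑ y ∈ U, (a x * a y * a (x + y) +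
      (1 - a x) * (1 - a y) * (1 - a (x + y))) =
      U.card - A.card - A.card - U.card * a x + 2 * a x * A.card +
        ∑ y ∈ U, a y * a (x + y) := by
    intro x hx
    have e1 : ∀ y, a x * a y * a (x + y) + (1 - a x) * (1 - a y) * (1 - a (x + y)) =
        1 - a y - a (x + y) - a x + a x * a y + a x * a (x + y) + a y * a (x + y) := by
      intro y; ring
    simp only [e1, Finset.sum_add_distrib, Finset.sum_sub_distrib, ← Finset.mul_sum,
      hsum, hshift x hx, Finset.sum_const, nsmul_eq_mul]
    ring
  have hlast : ∑ x ∈ U, ∑ y ∈ U, a y * a (x + y) = A.card ^ 2 := by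
    rw [Finset.sum_comm]
    have : ∀ y ∈ U, ∑ x ∈ U, a y * a (x + y) = a y * A.card := by
      intro y hy
      simp only [add_comm _ y, ← Finset.mul_sum, hshift y hy]
    rw [Finset.sum_congr rfl this, ← Finset.sum_mul, hsum, sq]
  rw [Finset.sum_congr rfl key]
  simp only [Finset.sum_add_distrib, Finset.sum_sub_distrib, ← Finset.mul_sum, ← Finset.sum_mul,
      hsum, hlast, Finset.sum_const, nsmul_eq_mul]
  ring

lemma addTriples_le_split {m : ℕ} (A : Finset (V m)) (u : V m) :
    addTriples A ≤ addTriples (A.filter (fun x => u ⬝ᵥ x = 0)) +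
      3 * (A.filter (fun x => ¬ u ⬝ᵥ x = 0)).card ^ 2 := by
  set A₀ := A.filter (fun x => u ⬝ᵥ x = 0) with hA₀
  set A₁ := A.filter (fun x => ¬ u ⬝ᵥ x = 0) with hA₁
  have hsub : (A ×ˢ A).filter (fun p => p.1 + p.2 ∈ A) ⊆
      (A₀ ×ˢ A₀).filter (fun p => p.1 + p.2 ∈ A₀) ∪ (A₁ ×ˢ A₁ ∪
        ((A₁ ×ˢ A₁).image (fun p => (p.1 + p.2, p.1)) ∪
          (A₁ ×ˢ A₁).image (fun p => (p.1, p.1 + p.2)))) := by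
    rintro ⟨x, y⟩ hxy
    simp only [Finset.mem_filter, Finset.mem_product] at hxy
    obtain ⟨⟨hx, hy⟩, hz⟩ := hxy
    simp only [Finset.mem_union, Finset.mem_image, Finset.mem_filter, Finset.mem_product,
      Prod.mk.injEq, Prod.exists, hA₀, hA₁, hx, hy, hz, true_and, dotProduct_add]
    by_cases h1 : u ⬝ᵥ x = 0 <;> by_cases h2 : u ⬝ᵥ y = 0
    · simp [h1, h2]
    · refine Or.inr (Or.inr (Or.inl ⟨y, x + y, ⟨⟨hy, h2⟩, hz, ?_⟩, ?_, rfl⟩))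
      · simpa [dotProduct_add, h1] using h2
      · rw [add_comm x y, vec_add_cancel]
    · refine Or.inr (Or.inr (Or.inr ⟨x, x + y, ⟨⟨hx, h1⟩, hz, ?_⟩, rfl, ?_⟩))
      · simpa [dotProduct_add, h2] using h1
      · rw [vec_add_cancel]
    · simp [h1, h2]
  have h := Finset.card_le_card hsub
  have e1 := Finset.card_union_le ((A₀ ×ˢ A₀).filter (fun p => p.1 + p.2 ∈ A₀)) (A₁ ×ˢ A₁ ∪
        ((A₁ ×ˢ A₁).image (fun p => (p.1 + p.2, p.1)) ∪
          (A₁ ×ˢ A₁).image (fun p => (p.1, p.1 + p.2))))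
  have e2 := Finset.card_union_le (A₁ ×ˢ A₁) ((A₁ ×ˢ A₁).image (fun p => (p.1 + p.2, p.1)) ∪
          (A₁ ×ˢ A₁).image (fun p => (p.1, p.1 + p.2)))
  have e3 := Finset.card_union_le ((A₁ ×ˢ A₁).image (fun p => (p.1 + p.2, p.1)))
          ((A₁ ×ˢ A₁).image (fun p => (p.1, p.1 + p.2)))
  have e4 := Finset.card_image_le (s := A₁ ×ˢ A₁) (f := fun p => (p.1 + p.2, p.1))
  have e5 := Finset.card_image_le (s := A₁ ×ˢ A₁) (f := fun p => (p.1, p.1 + p.2))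
  rw [Finset.card_product] at e2 e4 e5
  unfold addTriples
  nlinarith

/-- The maximal number of additive triples in a set of `n` vectors. -/
def maxTriples (n : ℕ) : ℤ :=
  (2 ^ Nat.log 2 n : ℤ) ^ 2 + 3 * (n - 2 ^ Nat.log 2 n) ^ 2

lemma maxTriples_eq {n j : ℕ} (h1 : 2 ^ j ≤ n) (h2 : n ≤ 2 * 2 ^ j) :
    maxTriples n = (2 ^ j : ℤ) ^ 2 + 3 * (n - 2 ^ j) ^ 2 := by
  unfold maxTriples
  rcases h2.lt_or_eq with h | h
  · rw [Nat.log_eq_of_pow_le_of_lt_pow h1 (by rw [pow_succ]; omega)]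
  · rw [← pow_succ'] at h
    subst h
    rw [Nat.log_pow (by norm_num)]
    push_cast
    ring

/-! ### The upper bound for the number of additive triples -/

lemma chrSum_eq_sub {m : ℕ} (A : Finset (V m)) (u : V m) :
    chrSum A u = (A.filter (fun x => u ⬝ᵥ x = 0)).card -
      (A.filter (fun x => ¬ u ⬝ᵥ x = 0)).card := by
  simp only [chrSum, chr, Finset.sum_ite, Finset.sum_const, nsmul_eq_mul]
  ring

lemma card_filter_add_card_filter {m : ℕ} (A : Finset (V m)) (u : V m) :
    (A.filter (fun x => u ⬝ᵥ x = 0)).card + (A.filter (fun x => ¬ u ⬝ᵥ x = 0)).card = A.card :=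
  Finset.card_filter_add_card_filter_not _

lemma exists_max_chrSum {m : ℕ} {A : Finset (V m)} (h0 : 0 ∈ A)
    (hK : 2 * A.card * (annih A).card ≤ 2 ^ m) :
    ∃ u ∉ annih A, (∀ w ∉ annih A, chrSum A w ≤ chrSum A u) ∧ 0 < chrSum A u ∧
      addTriples A ≤ A.card * (A.filter (fun x => u ⬝ᵥ x = 0)).card := by
  have hn : 0 < A.card := Finset.card_pos.2 ⟨0, h0⟩
  have hpow : 0 < 2 ^ m := by positivity
  have split : ∀ g : V m → ℤ, ∑ w, g w = ∑ w ∈ annih A, g w + ∑ w ∈ (annih A)ᶜ, g w :=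
    fun g => (Finset.sum_add_sum_compl _ g).symm
  have s1 := sum_chrSum h0
  have s2 := sum_chrSum_sq A
  have s3 := sum_chrSum_cube A
  rw [split] at s1 s2 s3
  rw [Finset.sum_congr rfl (fun w hw => chrSum_of_mem_annih hw), Finset.sum_const,
    nsmul_eq_mul] at s1
  rw [Finset.sum_congr rfl (fun w hw => by rw [chrSum_of_mem_annih hw]), Finset.sum_const,
    nsmul_eq_mul] at s2 s3
  zify at hK hn hpow
  have hpos : 0 < ∑ w ∈ (annih A)ᶜ, chrSum A w := by nlinarith
  have hne : ((annih A)ᶜ).Nonempty := by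
    rw [Finset.nonempty_iff_ne_empty]
    intro h
    simp [h] at hpos
  obtain ⟨u, hu, hmax⟩ := Finset.exists_max_image _ (chrSum A) hne
  have hupos : 0 < chrSum A u := by
    by_contra! h
    exact absurd hpos (not_lt.2 (Finset.sum_nonpos fun w hw => (hmax w hw).trans h))
  have hcube : ∑ w ∈ (annih A)ᶜ, chrSum A w ^ 3 ≤
      chrSum A u * ∑ w ∈ (annih A)ᶜ, chrSum A w ^ 2 := by
    rw [Finset.mul_sum]
    refine Finset.sum_le_sum fun w hw => ?_
    nlinarith [hmax w hw, sq_nonneg (chrSum A w)]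
  refine ⟨u, by simpa using hu, fun w hw => hmax w (by simpa using hw), hupos, ?_⟩
  have hc := card_filter_add_card_filter A u
  have hs := chrSum_eq_sub A u
  zify at hc ⊢
  set p : ℤ := ((A.filter (fun x => u ⬝ᵥ x = 0)).card : ℤ)
  set q : ℤ := ((A.filter (fun x => ¬ u ⬝ᵥ x = 0)).card : ℤ)
  have hq0 : 0 ≤ q := by positivity
  set n : ℤ := (A.card : ℤ)
  set K : ℤ := ((annih A).card : ℤ)
  set N : ℤ := 2 ^ m
  have hs2 : ∑ w ∈ (annih A)ᶜ, chrSum A w ^ 2 = N * n - K * n ^ 2 := by linarith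
  rw [hs2, hs] at hcube
  have h1 : N * (addTriples A : ℤ) ≤ K * n ^ 3 + (p - q) * (N * n - K * n ^ 2) := by linarith
  have h2 : K * n ^ 3 + (p - q) * (N * n - K * n ^ 2) =
      (2 * n * K) * (n * q) + N * n * (p - q) := by
    rw [← hc]; ring
  have h3 : (2 * n * K) * (n * q) ≤ N * (n * q) :=
    mul_le_mul_of_nonneg_right hK (by positivity)
  have h4 : N * (addTriples A : ℤ) ≤ N * (n * p) := by
    calc _ ≤ N * (n * q) + N * n * (p - q) := by linarith
      _ = _ := by ring
  exact le_of_mul_le_mul_left h4 hpow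

/-- Cutting `A` by a hyperplane containing as many of its elements as possible doubles the
annihilator. -/
lemma card_annih_filter_le {m : ℕ} {A : Finset (V m)} {u : V m}
    (hmax : ∀ w ∉ annih A, chrSum A w ≤ chrSum A u) :
    (annih (A.filter (fun x => u ⬝ᵥ x = 0))).card ≤ 2 * (annih A).card := by
  have hsub : annih (A.filter (fun x => u ⬝ᵥ x = 0)) ⊆ annih A ∪ (annih A).image (u + ·) := by
    intro w hw
    rw [Finset.mem_union]
    by_cases hwA : w ∈ annih A
    · exact Or.inl hwA
    refine Or.inr (Finset.mem_image.2 ⟨u + w, ?_, vec_add_cancel u w⟩)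
    have h1 := hmax w hwA
    rw [chrSum_eq_sub, chrSum_eq_sub] at h1
    have h2 := card_filter_add_card_filter A u
    have h3 := card_filter_add_card_filter A w
    have hle : A.filter (fun x => ¬ w ⬝ᵥ x = 0) ⊆ A.filter (fun x => ¬ u ⬝ᵥ x = 0) := by
      intro x hx
      rw [Finset.mem_filter] at hx ⊢
      exact ⟨hx.1, fun h => hx.2 (mem_annih.1 hw x (Finset.mem_filter.2 ⟨hx.1, h⟩))⟩
    have heq := Finset.eq_of_subset_of_card_le hle (by omega)
    rw [mem_annih]
    intro x hx
    have : (¬ w ⬝ᵥ x = 0) ↔ ¬ u ⬝ᵥ x = 0 := by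
      have := congrArg (x ∈ ·) heq
      simpa [hx] using this
    rw [add_dotProduct]
    generalize w ⬝ᵥ x = a at this
    generalize u ⬝ᵥ x = b at this
    revert a b
    decide
  calc _ ≤ _ := Finset.card_le_card hsub
    _ ≤ _ := Finset.card_union_le _ _
    _ ≤ 2 * (annih A).card := by
      have := Finset.card_image_le (s := annih A) (f := (u + ·))
      omega

lemma exists_pow_two_bounds {n : ℕ} (hn : 0 < n) : ∃ j, 2 ^ j ≤ n ∧ n < 2 * 2 ^ j :=
  ⟨Nat.log 2 n, Nat.pow_log_le_self 2 hn.ne', by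
    rw [← pow_succ']; exact Nat.lt_pow_succ_log_self (by norm_num) n⟩

lemma addTriples_le_of_half_lt {m : ℕ} {A : Finset (V m)}
    (hK : 2 ^ m < 2 * A.card * (annih A).card) : (addTriples A : ℤ) ≤ maxTriples A.card := by
  have hU : ∀ x ∈ annih (annih A), ∀ y ∈ annih (annih A), x + y ∈ annih (annih A) :=
    fun x hx y hy => add_mem_annih hx hy
  have hsub := subset_annih_annih A
  have h := addTriples_compl hU hsub
  have hle := Finset.card_le_card hsub
  obtain ⟨k, l, hk, hl, hkl⟩ := exists_card_annih A
  rw [hl] at h hle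
  rw [hk, hkl] at hK
  have hK' : 2 ^ l < 2 * A.card := lt_of_mul_lt_mul_right hK (by positivity)
  have hpos : (0 : ℤ) ≤ addTriples (annih (annih A) \ A) := by positivity
  rcases l with _ | l
  · have hn : A.card = 1 := by
      simp only [pow_zero] at hle hK'
      omega
    rw [hn, maxTriples_eq (j := 0) (by norm_num) (by norm_num)]
    rw [hn] at h
    push_cast at h ⊢
    linarith
  · rw [pow_succ] at hK' hle
    rw [maxTriples_eq (j := l) (by omega) (by omega)]
    push_cast [pow_succ] at h ⊢
    linarith

/-- The arithmetic behind cutting by a hyperplane far from the balanced case. -/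
lemma split_bound_aux {P s q : ℤ} (hq : 0 < q) (hs : 0 < s) (hsP : s < P) (hqP : q < P) :
    P ^ 2 + 3 * s ^ 2 + 3 * q ^ 2 < P ^ 2 + 3 * (s + q) ^ 2 ∧
      P ^ 2 + 3 * s ^ 2 + 3 * q ^ 2 < (2 * P) ^ 2 + 3 * (s + q - P) ^ 2 := by
  constructor
  · nlinarith [mul_pos hs hq]
  · nlinarith [mul_pos (sub_pos.2 hsP) (sub_pos.2 hqP)]

/-- The arithmetic behind cutting by a nearly balanced hyperplane. -/
lemma balanced_bound_aux {P s u : ℤ} (hu : 0 ≤ u) (hus : u < s) (hsP : s < P) :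
    (2 * P + s + u) * (P + s) < (2 * P) ^ 2 + 3 * (s + u) ^ 2 := by
  have key : 0 < 2 * P ^ 2 + 2 * s ^ 2 + 3 * u ^ 2 + 5 * s * u - 3 * P * s - P * u := by
    rcases le_or_gt P (5 * s) with h | h
    · have : 0 ≤ u * (5 * s - P) := mul_nonneg hu (by linarith)
      have hP : 0 < P := by linarith
      nlinarith [sq_nonneg (4 * s - 3 * P), sq_nonneg u, mul_pos hP hP]
    · have hP : 0 < P := by linarith
      nlinarith [mul_pos hP hP, mul_nonneg hu (show 0 ≤ s by linarith), sq_nonneg u, sq_nonneg s,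
        mul_pos hP (show 0 < P - 5 * s by linarith), mul_pos hP (show 0 < s - u by linarith)]
  nlinarith

theorem addTriples_le_maxTriples {m : ℕ} (n : ℕ) : ∀ A : Finset (V m), 0 ∈ A → A.card = n →
    (addTriples A : ℤ) ≤ maxTriples n ∧
      (2 * A.card * (annih A).card ≤ 2 ^ m → (addTriples A : ℤ) < maxTriples n) := by
  induction n using Nat.strong_induction_on with
  | _ n ih =>
  intro A h0 hcard
  suffices h : 2 * A.card * (annih A).card ≤ 2 ^ m → (addTriples A : ℤ) < maxTriples n by
    refine ⟨?_, h⟩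
    rcases le_or_gt (2 * A.card * (annih A).card) (2 ^ m) with hK | hK
    · exact (h hK).le
    · exact hcard ▸ addTriples_le_of_half_lt hK
  intro hK
  obtain ⟨u, hu, hmax, hupos, hT⟩ := exists_max_chrSum h0 hK
  have hKu := card_annih_filter_le hmax
  have hsplit := addTriples_le_split A u
  have hpq := card_filter_add_card_filter A u
  rw [chrSum_eq_sub] at hupos
  have h0' : (0 : V m) ∈ A.filter (fun x => u ⬝ᵥ x = 0) := by simp [h0]
  have hq : 0 < (A.filter (fun x => ¬ u ⬝ᵥ x = 0)).card := by
    rw [mem_annih] at hu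
    push Not at hu
    obtain ⟨x, hx, hux⟩ := hu
    exact Finset.card_pos.2 ⟨x, Finset.mem_filter.2 ⟨hx, hux⟩⟩
  obtain ⟨ih1, ih2⟩ := ih _ (by omega) _ h0' rfl
  set A₀ := A.filter (fun x => u ⬝ᵥ x = 0)
  set p := A₀.card
  set q := (A.filter (fun x => ¬ u ⬝ᵥ x = 0)).card
  rw [hcard] at hK hT hpq
  obtain ⟨j, hj1, hj2⟩ := exists_pow_two_bounds (n := p) (by omega)
  rw [maxTriples_eq hj1 hj2.le] at ih1 ih2
  have hsplit' : (addTriples A : ℤ) ≤ addTriples A₀ + 3 * (q : ℤ) ^ 2 := by exact_mod_cast hsplit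
  have hT' : (addTriples A : ℤ) ≤ n * p := by exact_mod_cast hT
  have hn : (n : ℤ) = p + q := by exact_mod_cast hpq.symm
  have hqp : q < p := by omega
  rcases hj1.eq_or_lt with hpP | hpP
  · -- the elements in the hyperplane are too few to form a subgroup
    have hK₀ : 2 * p * (annih A₀).card ≤ 2 ^ m := by
      obtain ⟨k, l, hk, hl, hkl⟩ := exists_card_annih A
      rw [hk] at hK hKu
      rw [hkl] at hK ⊢
      have h2 : 2 * n ≤ 2 ^ l := le_of_mul_le_mul_right hK (by positivity)
      have h3 : 2 ^ (j + 1) < 2 ^ l := by rw [pow_succ]; omega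
      have h4 : 2 ^ (j + 2) ≤ 2 ^ l :=
        Nat.pow_le_pow_right (by norm_num) ((Nat.pow_lt_pow_iff_right (by norm_num)).1 h3)
      calc 2 * p * (annih A₀).card ≤ 2 * p * (2 * 2 ^ k) := Nat.mul_le_mul_left _ hKu
        _ = 2 ^ (j + 2) * 2 ^ k := by rw [← hpP]; ring
        _ ≤ 2 ^ l * 2 ^ k := Nat.mul_le_mul_right _ h4
    rw [maxTriples_eq (j := j) (by omega) (by omega), hn]
    have := ih2 hK₀
    have hpP' : (p : ℤ) = 2 ^ j := by exact_mod_cast hpP.symm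
    rw [hpP'] at this ⊢
    linarith
  · have hP : (2 : ℤ) ^ j < p := by exact_mod_cast hpP
    have hP2 : (p : ℤ) < 2 * 2 ^ j := by exact_mod_cast hj2
    rcases lt_or_ge q (2 ^ j) with hqP | hqP
    · have hqP' : (q : ℤ) < 2 ^ j := by exact_mod_cast hqP
      obtain ⟨b1, b2⟩ := split_bound_aux (P := 2 ^ j) (s := p - 2 ^ j) (q := q)
        (by exact_mod_cast hq) (by linarith) (by linarith) hqP'
      rcases le_or_gt n (2 * 2 ^ j) with h | h
      · rw [maxTriples_eq (j := j) (by omega) h, hn,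
          show (p + q - 2 ^ j : ℤ) = p - 2 ^ j + q by ring]
        linarith
      · rw [maxTriples_eq (j := j + 1) (by rw [pow_succ]; omega) (by rw [pow_succ]; omega), hn,
          pow_succ' (2 : ℤ) j, show (p + q - 2 * 2 ^ j : ℤ) = p - 2 ^ j + q - 2 ^ j by ring]
        linarith
    · have hqP' : (2 : ℤ) ^ j ≤ q := by exact_mod_cast hqP
      have b := balanced_bound_aux (P := 2 ^ j) (s := p - 2 ^ j) (u := q - 2 ^ j)
        (by linarith) (by linarith) (by linarith)
      rw [maxTriples_eq (j := j + 1) (by rw [pow_succ]; omega) (by rw [pow_succ]; omega), hn,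
          pow_succ' (2 : ℤ) j, show (p + q - 2 * 2 ^ j : ℤ) = p - 2 ^ j + (q - 2 ^ j) by ring]
      rw [hn] at hT'
      have e : (2 * 2 ^ j + (p - 2 ^ j) + (q - 2 ^ j)) * (2 ^ j + (p - 2 ^ j)) =
        ((p : ℤ) + q) * p := by ring
      linarith

/-! ### Sets attaining the bound -/

lemma exists_subgroup_card {m : ℕ} {U : Finset (V m)} (h0 : 0 ∈ U)
    (hU : ∀ x ∈ U, ∀ y ∈ U, x + y ∈ U) (j : ℕ) (hj : 2 ^ j ≤ U.card) :
    ∃ W ⊆ U, 0 ∈ W ∧ (∀ x ∈ W, ∀ y ∈ W, x + y ∈ W) ∧ W.card = 2 ^ j := by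
  induction j with
  | zero => exact ⟨{0}, by simpa using h0, by simp, by simp, by simp⟩
  | succ j ih =>
    have hlt : 2 ^ j < 2 ^ (j + 1) := Nat.pow_lt_pow_right (by norm_num) j.lt_succ_self
    obtain ⟨W, hWU, hW0, hW, hcard⟩ := ih (by omega)
    obtain ⟨v, hvU, hvW⟩ := Finset.exists_mem_notMem_of_card_lt_card (s := W) (t := U) (by omega)
    refine ⟨W ∪ W.image (v + ·), ?_, Finset.mem_union_left _ hW0, ?_, ?_⟩
    · refine Finset.union_subset hWU fun x hx => ?_
      obtain ⟨w, hw, rfl⟩ := Finset.mem_image.1 hx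
      exact hU v hvU w (hWU hw)
    · intro x hx y hy
      simp only [Finset.mem_union, Finset.mem_image] at hx hy ⊢
      rcases hx with hx | ⟨x, hx, rfl⟩ <;> rcases hy with hy | ⟨y, hy, rfl⟩
      · exact Or.inl (hW x hx y hy)
      · exact Or.inr ⟨x + y, hW x hx y hy, by abel⟩
      · exact Or.inr ⟨x + y, hW x hx y hy, by abel⟩
      · refine Or.inl ?_
        have : v + x + (v + y) = v + (v + (x + y)) := by abel
        rw [this, vec_add_cancel]
        exact hW x hx y hy
    · rw [Finset.card_union_of_disjoint, Finset.card_image_of_injective _ (add_right_injective v),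
        hcard, pow_succ]
      · ring
      · rw [Finset.disjoint_left]
        intro x hx hx'
        obtain ⟨w, hw, rfl⟩ := Finset.mem_image.1 hx'
        have := hW _ hx w hw
        rw [add_assoc, vec_add_self, add_zero] at this
        exact hvW this

lemma le_addTriples_union {m : ℕ} {W S : Finset (V m)} (hdisj : Disjoint W S)
    (hW : ∀ x ∈ W, ∀ y ∈ W, x + y ∈ W) (hS : ∀ x ∈ S, ∀ y ∈ S, x + y ∈ W) :
    W.card ^ 2 + 3 * S.card ^ 2 ≤ addTriples (W ∪ S) := by
  have hd : ∀ x ∈ W, x ∉ S := fun _ hx => Finset.disjoint_left.1 hdisj hx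
  let X := (S ×ˢ S).image (fun p => (p.1, p.1 + p.2))
  let Y := (S ×ˢ S).image (fun p => (p.1 + p.2, p.1))
  have hX : X.card = S.card ^ 2 := by
    rw [Finset.card_image_of_injective, Finset.card_product, sq]
    rintro ⟨a, b⟩ ⟨c, d⟩ h
    simp only [Prod.mk.injEq] at h ⊢
    obtain ⟨rfl, h⟩ := h
    exact ⟨rfl, add_left_cancel h⟩
  have hY : Y.card = S.card ^ 2 := by
    rw [Finset.card_image_of_injective, Finset.card_product, sq]
    rintro ⟨a, b⟩ ⟨c, d⟩ h
    simp only [Prod.mk.injEq] at h ⊢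
    obtain ⟨h, rfl⟩ := h
    exact ⟨rfl, add_left_cancel h⟩
  have hmX : ∀ p ∈ X, p.1 ∈ S ∧ p.2 ∈ W ∧ p.1 + p.2 ∈ S := by
    intro p hp
    obtain ⟨⟨a, b⟩, hq, rfl⟩ := Finset.mem_image.1 hp
    rw [Finset.mem_product] at hq
    exact ⟨hq.1, hS a hq.1 b hq.2, by simpa only [vec_add_cancel] using hq.2⟩
  have hmY : ∀ p ∈ Y, p.1 ∈ W ∧ p.2 ∈ S ∧ p.1 + p.2 ∈ S := by
    intro p hp
    obtain ⟨⟨a, b⟩, hq, rfl⟩ := Finset.mem_image.1 hp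
    rw [Finset.mem_product] at hq
    exact ⟨hS a hq.1 b hq.2, hq.1, by simpa only [add_comm _ a, vec_add_cancel] using hq.2⟩
  have hcard : (((W ×ˢ W) ∪ (S ×ˢ S)) ∪ (X ∪ Y)).card = W.card ^ 2 + 3 * S.card ^ 2 := by
    rw [Finset.card_union_of_disjoint, Finset.card_union_of_disjoint,
      Finset.card_union_of_disjoint, hX, hY, Finset.card_product, Finset.card_product]
    · ring
    · exact Finset.disjoint_left.2 fun p h1 h2 => hd _ (hmY p h2).1 (hmX p h1).1
    · exact Finset.disjoint_left.2 fun p h1 h2 =>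
        hd _ (Finset.mem_product.1 h1).1 (Finset.mem_product.1 h2).1
    · refine Finset.disjoint_left.2 fun p h1 h2 => ?_
      rw [Finset.mem_union, Finset.mem_product, Finset.mem_product] at h1
      rcases h1 with h1 | h1 <;> rcases Finset.mem_union.1 h2 with h2 | h2
      · exact hd _ h1.1 (hmX p h2).1
      · exact hd _ h1.2 (hmY p h2).2.1
      · exact hd _ (hmX p h2).2.1 h1.2
      · exact hd _ (hmY p h2).1 h1.1
  rw [← hcard]
  refine Finset.card_le_card fun p hp => ?_
  simp only [Finset.mem_filter, Finset.mem_product, Finset.mem_union] at hp ⊢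
  rcases hp with (h | h) | h | h
  · exact ⟨⟨Or.inl h.1, Or.inl h.2⟩, Or.inl (hW _ h.1 _ h.2)⟩
  · exact ⟨⟨Or.inr h.1, Or.inr h.2⟩, Or.inl (hS _ h.1 _ h.2)⟩
  · have := hmX p h
    exact ⟨⟨Or.inr this.1, Or.inl this.2.1⟩, Or.inr this.2.2⟩
  · have := hmY p h
    exact ⟨⟨Or.inl this.1, Or.inr this.2.1⟩, Or.inr this.2.2⟩

lemma exists_maxTriples_le {m : ℕ} {U : Finset (V m)} (h0 : 0 ∈ U)
    (hU : ∀ x ∈ U, ∀ y ∈ U, x + y ∈ U) {n : ℕ} (hn : 0 < n) (hnU : n ≤ U.card) :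
    ∃ A ⊆ U, 0 ∈ A ∧ A.card = n ∧ maxTriples n ≤ addTriples A := by
  obtain ⟨j, hj1, hj2⟩ := exists_pow_two_bounds hn
  obtain ⟨W, hWU, hW0, hW, hcard⟩ := exists_subgroup_card h0 hU j (hj1.trans hnU)
  obtain ⟨S, hSU, hdisj, hSW, hScard⟩ : ∃ S ⊆ U, Disjoint W S ∧
      (∀ x ∈ S, ∀ y ∈ S, x + y ∈ W) ∧ S.card = n - 2 ^ j := by
    rcases hj1.eq_or_lt with h | h
    · exact ⟨∅, by simp, by simp, by simp, by simp [h]⟩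
    obtain ⟨v, hvU, hvW⟩ := Finset.exists_mem_notMem_of_card_lt_card (s := W) (t := U) (by omega)
    obtain ⟨R, hRW, hR⟩ := Finset.exists_subset_card_eq (s := W) (n := n - 2 ^ j) (by omega)
    refine ⟨R.image (v + ·), ?_, ?_, ?_, ?_⟩
    · intro x hx
      obtain ⟨w, hw, rfl⟩ := Finset.mem_image.1 hx
      exact hU v hvU w (hWU (hRW hw))
    · rw [Finset.disjoint_left]
      intro x hx hx'
      obtain ⟨w, hw, rfl⟩ := Finset.mem_image.1 hx'
      have := hW _ hx w (hRW hw)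
      rw [add_assoc, vec_add_self, add_zero] at this
      exact hvW this
    · intro x hx y hy
      obtain ⟨a, ha, rfl⟩ := Finset.mem_image.1 hx
      obtain ⟨b, hb, rfl⟩ := Finset.mem_image.1 hy
      have : v + a + (v + b) = v + (v + (a + b)) := by abel
      rw [this, vec_add_cancel]
      exact hW a (hRW ha) b (hRW hb)
    · rw [Finset.card_image_of_injective _ (add_right_injective v), hR]
  refine ⟨W ∪ S, Finset.union_subset hWU hSU, Finset.mem_union_left _ hW0, ?_, ?_⟩
  · rw [Finset.card_union_of_disjoint hdisj]
    omega
  · have := le_addTriples_union hdisj hW hSW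
    rw [hcard, hScard] at this
    zify [hj1] at this
    rwa [maxTriples_eq hj1 hj2.le]

/-! ### Automorphisms of `V m` -/

/-- The transvection `x ↦ x + (w ⬝ᵥ x) • v`. -/
def transvect {m : ℕ} (w v : V m) (h : w ⬝ᵥ v = 0) : V m ≃+ V m where
  toFun x := x + (w ⬝ᵥ x) • v
  invFun x := x + (w ⬝ᵥ x) • v
  left_inv x := by
    simp only [dotProduct_add, dotProduct_smul, h, smul_zero, add_zero]
    rw [add_assoc, vec_add_self, add_zero]
  right_inv x := by
    simp only [dotProduct_add, dotProduct_smul, h, smul_zero, add_zero]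
    rw [add_assoc, vec_add_self, add_zero]
  map_add' x y := by
    simp only [dotProduct_add, add_smul]
    abel

lemma transvect_apply {m : ℕ} (w v : V m) (h : w ⬝ᵥ v = 0) (x : V m) :
    transvect w v h x = x + (w ⬝ᵥ x) • v := rfl

/-- Every hyperplane is the image of the even-weight hyperplane under an automorphism. -/
lemma exists_addEquiv_sum_eq {m : ℕ} {u : V m} (hu : u ≠ 0) :
    ∃ g : V m ≃+ V m, ∀ x, ∑ i, g x i = u ⬝ᵥ x := by
  obtain ⟨i, hi⟩ := exists_coord_eq_one hu
  have hz : (u + 1) ⬝ᵥ (Pi.single i 1 : V m) = 0 := by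
    simp [hi]
    decide
  refine ⟨transvect (u + 1) (Pi.single i 1) hz, fun x => ?_⟩
  have hsum : ∑ j, (Pi.single i 1 : V m) j = 1 := by simp [Finset.sum_pi_single']
  simp only [transvect_apply, Pi.add_apply, Pi.smul_apply, Finset.sum_add_distrib, smul_eq_mul,
    ← Finset.mul_sum, hsum, mul_one]
  rw [add_dotProduct, one_dotProduct, add_left_comm, CharTwo.add_self_eq_zero, add_zero]

/-- The parity-preserving automorphisms act transitively on nonzero even-weight vectors. -/
lemma exists_addEquiv_of_mem_Em {m : ℕ} {ψ ψ' : V m} (h : ψ ∈ Em m) (h' : ψ' ∈ Em m) :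
    ∃ g : V m ≃+ V m, (∀ x, ∑ i, g x i = ∑ i, x i) ∧ g ψ = ψ' := by
  simp only [Em, Finset.mem_filter, Finset.mem_univ, true_and] at h h'
  obtain ⟨w, hw, hw'⟩ : ∃ w : V m, w ⬝ᵥ ψ = 1 ∧ w ⬝ᵥ ψ' = 1 := by
    obtain ⟨i, hi⟩ := exists_coord_eq_one h.1
    obtain ⟨j, hj⟩ := exists_coord_eq_one h'.1
    by_cases hij : ψ' i = 1
    · exact ⟨Pi.single i 1, by simp [hi], by simp [hij]⟩
    by_cases hji : ψ j = 1
    · exact ⟨Pi.single j 1, by simp [hji], by simp [hj]⟩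
    · have e1 : ψ' i = 0 := by simpa using mt zmod_two_eq_one_iff.2 hij
      have e2 : ψ j = 0 := by simpa using mt zmod_two_eq_one_iff.2 hji
      exact ⟨Pi.single i 1 + Pi.single j 1, by simp [add_dotProduct, hi, e2],
        by simp [add_dotProduct, hj, e1]⟩
  have hz : w ⬝ᵥ (ψ + ψ') = 0 := by
    rw [dotProduct_add, hw, hw']
    decide
  refine ⟨transvect w (ψ + ψ') hz, fun x => ?_, ?_⟩
  · simp only [transvect_apply, Pi.add_apply, Pi.smul_apply, Finset.sum_add_distrib, smul_eq_mul,
      ← Finset.mul_sum, h.2, h'.2, add_zero, mul_zero]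
  · rw [transvect_apply, hw, one_smul, vec_add_cancel]

lemma sumCount_map {m : ℕ} (g : V m ≃+ V m) (d : Finset (V m)) (i : ℕ) (ψ : V m) :
    sumCount m (d.map g.toEquiv.toEmbedding) i (g ψ) = sumCount m d i ψ := by
  rw [sumCount, sumCount, Finset.powersetCard_map, Finset.filter_map, Finset.card_map]
  congr 1
  refine Finset.filter_congr fun S _ => ?_
  have h : (S.map g.toEquiv.toEmbedding).sum id = g (S.sum id) := by
    rw [Finset.sum_map, map_sum]
    rfl
  exact (h ▸ g.injective.eq_iff : (S.map g.toEquiv.toEmbedding).sum id = g ψ ↔ S.sum id = ψ)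

lemma wordCount_map {m : ℕ} (g : V m ≃+ V m) (d : Finset (V m)) (i : ℕ) :
    wordCount m (d.map g.toEquiv.toEmbedding) i = wordCount m d i := by
  have := sumCount_map g d i 0
  rwa [map_zero] at this

/-! ### Words of small length -/

lemma sumCount_zero {m : ℕ} (d : Finset (V m)) (ψ : V m) :
    sumCount m d 0 ψ = if ψ = 0 then 1 else 0 := by
  rw [sumCount, Finset.powersetCard_zero, Finset.filter_singleton, Finset.sum_empty]
  by_cases h : ψ = 0
  · simp [h]
  · rw [if_neg (Ne.symm h), if_neg h, Finset.card_empty]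

lemma wordCount_one {m : ℕ} {d : Finset (V m)} (hd : d ⊆ Hm m) : wordCount m d 1 = 0 := by
  rw [wordCount, sumCount, Finset.card_eq_zero, Finset.filter_eq_empty_iff]
  intro S hS
  rw [Finset.mem_powersetCard, Finset.card_eq_one] at hS
  obtain ⟨hSd, x, rfl⟩ := hS
  have := hd (hSd (Finset.mem_singleton_self x))
  simpa [Hm] using this

lemma wordCount_two {m : ℕ} (d : Finset (V m)) : wordCount m d 2 = 0 := by
  rw [wordCount, sumCount, Finset.card_eq_zero, Finset.filter_eq_empty_iff]
  intro S hS
  rw [Finset.mem_powersetCard, Finset.card_eq_two] at hS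
  obtain ⟨-, x, y, hxy, rfl⟩ := hS
  rw [Finset.sum_pair hxy]
  exact fun h => hxy (vec_add_eq_zero_iff.1 h)

lemma six_mul_wordCount_three {m : ℕ} {d : Finset (V m)} (hd : d ⊆ Hm m) :
    6 * wordCount m d 3 = addTriples d := by
  have h0 : ∀ x ∈ d, x ≠ 0 := fun x hx => by simpa [Hm] using hd hx
  have hne : ∀ x ∈ d, ∀ y, x + y ∈ d → y ∈ d → x ≠ y ∧ x ≠ x + y ∧ y ≠ x + y := by
    intro x hx y hz hy
    refine ⟨fun h => h0 _ hz (vec_add_eq_zero_iff.2 h), fun h => h0 y hy (by simpa using h),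
      fun h => h0 x hx (by simpa using h)⟩
  rw [addTriples, Finset.card_eq_sum_card_fiberwise (f := fun p => {p.1, p.2, p.1 + p.2})
    (t := (d.powersetCard 3).filter (fun S => S.sum id = 0)), Finset.sum_const_nat (m := 6),
    wordCount, sumCount, mul_comm]
  · intro S hS
    rw [Finset.mem_filter, Finset.mem_powersetCard] at hS
    obtain ⟨⟨hSd, hS3⟩, hS0⟩ := hS
    have : S.offDiag.card = 6 := by rw [Finset.offDiag_card, hS3]
    rw [← this]
    congr 1
    ext ⟨x, y⟩
    simp only [Finset.mem_filter, Finset.mem_product, Finset.mem_offDiag]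
    constructor
    · rintro ⟨⟨⟨hx, hy⟩, hz⟩, rfl⟩
      exact ⟨by simp, by simp, (hne x hx y hz hy).1⟩
    · rintro ⟨hx, hy, hxy⟩
      have hsub : ({x, y} : Finset (V m)) ⊆ S := by
        intro z hz
        rw [Finset.mem_insert, Finset.mem_singleton] at hz
        rcases hz with rfl | rfl <;> assumption
      have h1 : (S \ {x, y}).card = 1 := by
        rw [Finset.card_sdiff_of_subset hsub, hS3, Finset.card_pair hxy]
      obtain ⟨z, hz⟩ := Finset.card_eq_one.1 h1
      have hsum := Finset.sum_sdiff (f := id) hsub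
      rw [hz, hS0, Finset.sum_singleton, Finset.sum_pair hxy, id, id, id,
        vec_add_eq_zero_iff] at hsum
      have hSeq : S = {x, y, x + y} := by
        rw [← Finset.sdiff_union_of_subset hsub, hz, hsum]
        ext w
        simp only [Finset.mem_union, Finset.mem_insert, Finset.mem_singleton]
        tauto
      refine ⟨⟨⟨hSd hx, hSd hy⟩, hSd ?_⟩, hSeq.symm⟩
      rw [hSeq]
      simp
  · rintro ⟨x, y⟩ hp
    simp only [Finset.coe_filter, Finset.mem_product, Set.mem_ofPred_eq] at hp
    obtain ⟨⟨hx, hy⟩, hz⟩ := hp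
    obtain ⟨n1, n2, n3⟩ := hne x hx y hz hy
    simp only [Finset.coe_filter, Finset.mem_powersetCard, Set.mem_ofPred_eq]
    refine ⟨⟨?_, Finset.card_eq_three.2 ⟨x, y, x + y, n1, n2, n3, rfl⟩⟩, ?_⟩
    · intro w hw
      simp only [Finset.mem_insert, Finset.mem_singleton] at hw
      rcases hw with rfl | rfl | rfl <;> assumption
    · rw [Finset.sum_insert (by simp only [Finset.mem_insert, Finset.mem_singleton]; tauto),
        Finset.sum_pair n3, id, id, id, ← add_assoc, vec_add_self]

/-! ### Words of `Om m ∪ e` -/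

lemma wordCount_union {m : ℕ} {O e : Finset (V m)} (hdisj : Disjoint O e) (i : ℕ) :
    wordCount m (O ∪ e) i = ∑ k ∈ Finset.range (i + 1), ∑ S ∈ e.powersetCard k,
      sumCount m O (i - k) (S.sum id) := by
  have hd : ∀ x ∈ O, x ∉ e := fun _ hx => Finset.disjoint_left.1 hdisj hx
  have hmaps : ∀ R ∈ ((O ∪ e).powersetCard i).filter (fun R => R.sum id = 0),
      R ∩ e ∈ e.powerset.filter (fun S => S.card ∈ Finset.range (i + 1)) := by
    intro R hR
    rw [Finset.mem_filter, Finset.mem_powersetCard] at hR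
    rw [Finset.mem_filter, Finset.mem_powerset, Finset.mem_range]
    have := Finset.card_le_card (Finset.inter_subset_left (s₁ := R) (s₂ := e))
    exact ⟨Finset.inter_subset_right, by omega⟩
  rw [wordCount, sumCount, Finset.card_eq_sum_card_fiberwise hmaps,
    ← Finset.sum_fiberwise_of_maps_to (g := Finset.card) (t := Finset.range (i + 1))
      (fun S hS => (Finset.mem_filter.1 hS).2)]
  refine Finset.sum_congr rfl fun k hk => ?_
  rw [Finset.mem_range] at hk
  refine Finset.sum_congr ?_ fun S hS => ?_
  · ext S
    simp only [Finset.mem_filter, Finset.mem_powerset, Finset.mem_powersetCard, Finset.mem_range]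
    constructor
    · rintro ⟨⟨h1, -⟩, h2⟩
      exact ⟨h1, h2⟩
    · rintro ⟨h1, h2⟩
      exact ⟨⟨h1, by omega⟩, h2⟩
  · rw [Finset.mem_powersetCard] at hS
    obtain ⟨hSe, hSk⟩ := hS
    have hdO : ∀ R ⊆ O, Disjoint R S := fun R hR =>
      Finset.disjoint_left.2 fun x hx hx' => hd x (hR hx) (hSe hx')
    rw [sumCount]
    refine Finset.card_bij' (fun R _ => R \ e) (fun R _ => R ∪ S) ?_ ?_ ?_ ?_
    · intro R hR
      simp only [Finset.mem_filter, Finset.mem_powersetCard] at hR ⊢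
      obtain ⟨⟨⟨hRs, hRc⟩, hR0⟩, rfl⟩ := hR
      have h1 := Finset.card_sdiff_add_card_inter R e
      have h2 := Finset.sum_inter_add_sum_sdiff R e (id : V m → V m)
      refine ⟨⟨?_, by omega⟩, ?_⟩
      · intro x hx
        rw [Finset.mem_sdiff] at hx
        exact (Finset.mem_union.1 (hRs hx.1)).resolve_right hx.2
      · rw [hR0, vec_add_eq_zero_iff] at h2
        exact h2.symm
    · intro R hR
      simp only [Finset.mem_filter, Finset.mem_powersetCard] at hR ⊢
      obtain ⟨⟨hRs, hRc⟩, hR0⟩ := hR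
      refine ⟨⟨⟨Finset.union_subset_union hRs hSe, ?_⟩, ?_⟩, ?_⟩
      · rw [Finset.card_union_of_disjoint (hdO R hRs)]
        omega
      · rw [Finset.sum_union (hdO R hRs), hR0, vec_add_self]
      · ext x
        simp only [Finset.mem_inter, Finset.mem_union]
        constructor
        · rintro ⟨h | h, hx⟩
          · exact absurd hx (hd x (hRs h))
          · exact h
        · exact fun h => ⟨Or.inr h, hSe h⟩
    · intro R hR
      simp only [Finset.mem_filter] at hR
      rw [← hR.2, Finset.sdiff_union_inter]
    · intro R hR
      simp only [Finset.mem_filter, Finset.mem_powersetCard] at hR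
      ext x
      simp only [Finset.mem_sdiff, Finset.mem_union]
      constructor
      · rintro ⟨h | h, hx⟩
        · exact h
        · exact absurd (hSe h) hx
      · exact fun h => ⟨Or.inl h, hd x (hR.1.1 h)⟩

lemma disjoint_Om_Em (m : ℕ) : Disjoint (Om m) (Em m) := by
  rw [Finset.disjoint_left]
  intro x hx hx'
  simp only [Om, Em, Finset.mem_filter, Finset.mem_univ, true_and] at hx hx'
  exact zero_ne_one (hx'.2.symm.trans hx)

lemma Om_union_subset_Hm {m : ℕ} {e : Finset (V m)} (he : e ⊆ Em m) : Om m ∪ e ⊆ Hm m := by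
  intro x hx
  simp only [Hm, Finset.mem_filter, Finset.mem_univ, true_and]
  rcases Finset.mem_union.1 hx with h | h
  · rintro rfl
    simp [Om] at h
  · have := he h
    simp only [Em, Finset.mem_filter] at this
    exact this.2.1

lemma card_Om_union {m : ℕ} {e : Finset (V m)} (he : e ⊆ Em m) :
    (Om m ∪ e).card = (Om m).card + e.card :=
  Finset.card_union_of_disjoint (Finset.disjoint_of_subset_right he (disjoint_Om_Em m))

lemma sumCount_Om_eq {m : ℕ} {ψ ψ' : V m} (h : ψ ∈ Em m) (h' : ψ' ∈ Em m) (j : ℕ) :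
    sumCount m (Om m) j ψ = sumCount m (Om m) j ψ' := by
  obtain ⟨g, hg, rfl⟩ := exists_addEquiv_of_mem_Em h h'
  rw [← sumCount_map g]
  congr 1
  ext x
  simp only [Finset.mem_map_equiv, Om, Finset.mem_filter, Finset.mem_univ, true_and]
  rw [← hg]
  exact (Eq.congr_left (by simp)).symm

lemma wordCount_Om_union {m : ℕ} {e : Finset (V m)} (he : e ⊆ Em m) {ψ : V m} (hψ : ψ ∈ Em m)
    (i : ℕ) : (wordCount m (Om m ∪ e) i : ℤ) = ∑ k ∈ Finset.range (i + 1),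
      (e.card.choose k * sumCount m (Om m) (i - k) ψ + wordCount m e k *
        ((sumCount m (Om m) (i - k) 0 : ℤ) - sumCount m (Om m) (i - k) ψ)) := by
  rw [wordCount_union (Finset.disjoint_of_subset_right he (disjoint_Om_Em m))]
  push_cast
  refine Finset.sum_congr rfl fun k _ => ?_
  have hval : ∀ S ∈ e.powersetCard k, (sumCount m (Om m) (i - k) (S.sum id) : ℤ) =
      sumCount m (Om m) (i - k) ψ + if S.sum id = 0 then
        ((sumCount m (Om m) (i - k) 0 : ℤ) - sumCount m (Om m) (i - k) ψ) else 0 := by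
    intro S hS
    split_ifs with h
    · rw [h]; ring
    · rw [add_zero, sumCount_Om_eq _ hψ]
      simp only [Em, Finset.mem_filter, Finset.mem_univ, true_and]
      refine ⟨h, ?_⟩
      simp only [Finset.sum_apply, id]
      rw [Finset.sum_comm]
      refine Finset.sum_eq_zero fun x hx => ?_
      have := he ((Finset.mem_powersetCard.1 hS).1 hx)
      simp only [Em, Finset.mem_filter] at this
      exact this.2.2
  rw [Finset.sum_congr rfl hval, Finset.sum_add_distrib, Finset.sum_const,
    Finset.card_powersetCard, ← Finset.sum_filter, Finset.sum_const, nsmul_eq_mul, nsmul_eq_mul]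
  rfl

/-- If the word-length patterns of `e` and `e'` agree below `s`, then adjoining `Om m` does not
change the difference of the numbers of words of length `s`. -/
lemma wordCount_Om_union_sub {m : ℕ} {e e' : Finset (V m)} (he : e ⊆ Em m) (he' : e' ⊆ Em m)
    (hcard : e.card = e'.card) {s : ℕ} (h : ∀ t < s, wordCount m e t = wordCount m e' t) :
    (wordCount m (Om m ∪ e) s : ℤ) - wordCount m (Om m ∪ e') s =
      wordCount m e s - wordCount m e' s := by
  rcases e.eq_empty_or_nonempty with rfl | ⟨ψ, hψ⟩
  · rw [Finset.card_empty, eq_comm, Finset.card_eq_zero] at hcard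
    rw [hcard]
    simp
  have hψ := he hψ
  have hψ0 : ψ ≠ 0 := by
    simp only [Em, Finset.mem_filter] at hψ
    exact hψ.2.1
  rw [wordCount_Om_union he hψ, wordCount_Om_union he' hψ, hcard, Finset.sum_range_succ,
    Finset.sum_range_succ, Finset.sum_congr rfl (fun k hk => by rw [h k (Finset.mem_range.1 hk)]),
    Nat.sub_self, sumCount_zero, sumCount_zero, if_pos rfl, if_neg hψ0]
  push_cast
  ring

lemma smallerAberration_Om_union_iff {m : ℕ} {e e' : Finset (V m)} (he : e ⊆ Em m)
    (he' : e' ⊆ Em m) (hcard : e.card = e'.card) :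
    SmallerAberration m (Om m ∪ e) (Om m ∪ e') ↔ SmallerAberration m e e' := by
  constructor
  · rintro ⟨s, hs, hlt, heq⟩
    have hall : ∀ t < s, wordCount m e t = wordCount m e' t := by
      intro t
      induction t using Nat.strong_induction_on with
      | _ t ih =>
      intro ht
      have h1 := wordCount_Om_union_sub he he' hcard (s := t) fun k hk => ih k hk (hk.trans ht)
      have h2 := heq t ht
      omega
    have := wordCount_Om_union_sub he he' hcard hall
    exact ⟨s, hs, by omega, hall⟩
  · rintro ⟨s, hs, hlt, heq⟩
    refine ⟨s, hs, ?_, fun t ht => ?_⟩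
    · have := wordCount_Om_union_sub he he' hcard heq
      omega
    · have h1 := wordCount_Om_union_sub he he' hcard fun k hk => heq k (hk.trans ht)
      have h2 := heq t ht
      omega

/-! ### Comparison with arbitrary designs -/

lemma SmallerAberration.trans {m : ℕ} {d₁ d₂ d₃ : Finset (V m)}
    (h : SmallerAberration m d₁ d₂) (h' : SmallerAberration m d₂ d₃) :
    SmallerAberration m d₁ d₃ := by
  obtain ⟨s, hs, hlt, heq⟩ := h
  obtain ⟨s', hs', hlt', heq'⟩ := h'
  rcases lt_trichotomy s s' with h | rfl | h
  · exact ⟨s, hs, heq' s h ▸ hlt, fun t ht => (heq t ht).trans (heq' t (ht.trans h))⟩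
  · exact ⟨s, hs, hlt.trans hlt', fun t ht => (heq t ht).trans (heq' t ht)⟩
  · exact ⟨s', hs', (heq s' h).symm ▸ hlt', fun t ht => (heq t (ht.trans h)).trans (heq' t ht)⟩

lemma smallerAberration_of_wordCount_three_lt {m : ℕ} {d d' : Finset (V m)} (hd : d ⊆ Hm m)
    (hd' : d' ⊆ Hm m) (h : wordCount m d 3 < wordCount m d' 3) : SmallerAberration m d d' := by
  refine ⟨3, by norm_num, h, fun t ht => ?_⟩
  interval_cases t
  · simp [wordCount, sumCount_zero]
  · rw [wordCount_one hd, wordCount_one hd']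
  · rw [wordCount_two, wordCount_two]

lemma mem_annih_one {m : ℕ} {x : V m} : x ∈ annih ({1} : Finset (V m)) ↔ ∑ i, x i = 0 := by
  simp [mem_annih, dotProduct]

lemma card_annih_one {m : ℕ} (hm : 0 < m) : (annih ({1} : Finset (V m))).card = 2 ^ (m - 1) := by
  have h1 : (1 : V m) ≠ 0 := fun h => one_ne_zero (congrFun h ⟨0, hm⟩)
  have h := card_mul_card_annih (A := ({0, 1} : Finset (V m))) (by simp) (by simp [vec_add_self])
  have h2 : annih ({0, 1} : Finset (V m)) = annih {1} := by
    ext u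
    simp [mem_annih]
  have hpow : 2 ^ m = 2 * 2 ^ (m - 1) := by rw [← pow_succ', Nat.sub_add_cancel hm]
  rw [Finset.card_pair h1.symm, h2, hpow] at h
  exact Nat.eq_of_mul_eq_mul_left two_pos h

/-- The complement of a set of even-weight vectors containing `0`. -/
lemma compl_eq_Om_union {m : ℕ} {A : Finset (V m)} (h0 : 0 ∈ A)
    (hA : A ⊆ annih ({1} : Finset (V m))) : Aᶜ = Om m ∪ (Em m \ A) := by
  ext x
  have hx := @hA x
  rw [mem_annih_one] at hx
  simp only [Finset.mem_compl, Finset.mem_union, Finset.mem_sdiff, Om, Em, Finset.mem_filter,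
    Finset.mem_univ, true_and, zmod_two_eq_one_iff]
  constructor
  · intro h
    by_cases hs : ∑ i, x i = 0
    · exact Or.inr ⟨⟨by rintro rfl; exact h h0, hs⟩, h⟩
    · exact Or.inl hs
  · rintro (h | h)
    · exact fun h' => h (hx h')
    · exact h.2

lemma six_mul_wordCount_three_compl {m : ℕ} {A : Finset (V m)} (h0 : 0 ∈ A) :
    (6 * wordCount m Aᶜ 3 : ℤ) = (2 ^ m) ^ 2 - 3 * 2 ^ m * A.card + 3 * A.card ^ 2
      - addTriples A := by
  have h1 := six_mul_wordCount_three (d := Aᶜ) fun x hx => by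
    simp only [Hm, Finset.mem_filter, Finset.mem_univ, true_and]
    rintro rfl
    exact Finset.mem_compl.1 hx h0
  have h2 := addTriples_compl (U := Finset.univ) (A := A) (by simp) (Finset.subset_univ A)
  rw [← Finset.compl_eq_univ_sdiff] at h2
  have h3 : (Finset.univ : Finset (V m)).card = 2 ^ m := by simp
  rw [h3] at h2
  zify at h1
  push_cast at h2
  linarith

/-- Every design with more than half of the vectors is at best as good as the union of `Om m`
with some even-weight vectors. -/
lemma exists_Om_union_le {m : ℕ} (hm : 0 < m) {d : Finset (V m)} (hd : d ⊆ Hm m)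
    (hcard : 2 ^ (m - 1) ≤ d.card) :
    ∃ e ⊆ Em m, (Om m ∪ e).card = d.card ∧ (SmallerAberration m (Om m ∪ e) d ∨
      ∀ i, wordCount m (Om m ∪ e) i = wordCount m d i) := by
  have h0 : 0 ∈ dᶜ := by
    rw [Finset.mem_compl]
    exact fun h => by simpa [Hm] using hd h
  have hpow : 2 ^ m = 2 * 2 ^ (m - 1) := by rw [← pow_succ', Nat.sub_add_cancel hm]
  have huniv : (Finset.univ : Finset (V m)).card = 2 * 2 ^ (m - 1) := by
    rw [← hpow]
    simp
  have hc := Finset.card_add_card_compl d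
  rw [Fintype.card, huniv] at hc
  by_cases hann : annih dᶜ = {0}
  · obtain ⟨A, hAU, hA0, hAcard, hA⟩ := exists_maxTriples_le (zero_mem_annih ({1} : Finset (V m)))
      (fun x hx y hy => add_mem_annih hx hy) (Finset.card_pos.2 ⟨0, h0⟩)
      (by rw [card_annih_one hm]; omega)
    have hcomp := compl_eq_Om_union hA0 hAU
    have hsub : Em m \ A ⊆ Em m := Finset.sdiff_subset
    refine ⟨Em m \ A, hsub, ?_, Or.inl ?_⟩
    · rw [← hcomp]
      have := Finset.card_add_card_compl A
      rw [Fintype.card, huniv] at this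
      omega
    · refine smallerAberration_of_wordCount_three_lt (Om_union_subset_Hm hsub) hd ?_
      have hlt := (addTriples_le_maxTriples _ dᶜ h0 rfl).2 (by
        rw [hann, Finset.card_singleton]; omega)
      have e1 := six_mul_wordCount_three_compl hA0
      have e2 := six_mul_wordCount_three_compl h0
      rw [compl_compl] at e2
      rw [hcomp, hAcard] at e1
      omega
  · obtain ⟨u, hu, hu0⟩ : ∃ u ∈ annih dᶜ, u ≠ 0 := by
      by_contra! h
      exact hann (Finset.eq_singleton_iff_unique_mem.2 ⟨zero_mem_annih _, h⟩)
    obtain ⟨g, hg⟩ := exists_addEquiv_sum_eq hu0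
    have hA0 : 0 ∈ dᶜ.map g.toEquiv.toEmbedding :=
      Finset.mem_map.2 ⟨0, h0, map_zero g⟩
    have hAU : dᶜ.map g.toEquiv.toEmbedding ⊆ annih ({1} : Finset (V m)) := by
      intro x hx
      obtain ⟨y, hy, rfl⟩ := Finset.mem_map.1 hx
      rw [mem_annih_one]
      exact (hg y).trans (mem_annih.1 hu y hy)
    have hcomp := compl_eq_Om_union hA0 hAU
    have hmap : (dᶜ.map g.toEquiv.toEmbedding)ᶜ = d.map g.toEquiv.toEmbedding := by
      ext x
      simp [Finset.mem_map_equiv]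
    rw [hmap] at hcomp
    refine ⟨_, Finset.sdiff_subset, by rw [← hcomp, Finset.card_map], Or.inr fun i => ?_⟩
    rw [← hcomp, wordCount_map]

/-- For `e ⊆ E_m` with `|e| = r`, `1 ≤ r ≤ 2^{m-1} - 1`, the design
`O_m ∪ e` is minimum aberration among subsets of `H_m` of cardinality `2^{m-1} + r`
iff no `r`-element subset of `E_m` has smaller aberration than `e`. -/
theorem union_IsMA_iff_e_MA_in_Em (m : ℕ) (hm : 2 ≤ m)
    (e : Finset (V m)) (he : e ⊆ Em m) (r : ℕ) (hr : e.card = r)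
    (hr1 : 1 ≤ r) (hr2 : r ≤ 2 ^ (m - 1) - 1) :
    IsMA m (Om m ∪ e) ↔
      ∀ e' ⊆ Em m, e'.card = r → ¬ SmallerAberration m e' e := by
  subst hr
  constructor
  · rintro ⟨-, h⟩ e' he' hcard hlt
    exact h (Om m ∪ e') (Om_union_subset_Hm he')
      (by rw [card_Om_union he, card_Om_union he', hcard])
      ((smallerAberration_Om_union_iff he' he hcard).2 hlt)
  · intro h
    refine ⟨Om_union_subset_Hm he, fun d hd hcard hlt => ?_⟩
    have hOm : 2 ^ (m - 1) ≤ (Om m).card := by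
      have h1 : annih ({1} : Finset (V m)) = (Om m)ᶜ := by
        ext x
        simp only [mem_annih_one, Om, Finset.mem_compl, Finset.mem_filter, Finset.mem_univ,
          true_and, zmod_two_eq_one_iff, not_not]
      have h2 := Finset.card_add_card_compl (Om m)
      rw [← h1, card_annih_one (by omega)] at h2
      have h3 : Fintype.card (V m) = 2 * 2 ^ (m - 1) := by
        rw [← pow_succ', Nat.sub_add_cancel (by omega)]
        simp
      omega
    obtain ⟨e', he', hcard', hle⟩ := exists_Om_union_le (by omega) hd
      (by rw [hcard, card_Om_union he]; omega)
    have hee : e'.card = e.card := by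
      rw [hcard, card_Om_union he, card_Om_union he'] at hcard'
      omega
    refine h e' he' hee ((smallerAberration_Om_union_iff he' he hee).1 ?_)
    rcases hle with hle | hle
    · exact hle.trans hlt
    · obtain ⟨s, hs, hlt, heq⟩ := hlt
      exact ⟨s, hs, by rwa [hle], fun t ht => by rw [hle, heq t ht]⟩
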